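/- Let P = J^3([2] × [3]) be the 3-fold iterated order-ideal poset of [2] × [3]. Then the width of P is 3, the poset (A_3(P), ≤_3) is a singleton, (A_1(P), ≤_1) is isomorphic to P, and (A_2(P), ≤_2) is isomorphic to P. Moreover, for P' = J^2([2] × [3]), the width of P' is 2 and (A_2(P'), ≤_2) is isomorphic to J^3([2] × [2]). -/

import Mathlib

/-- The product poset `[a] × [b]` of the chains `{1,…,a}` and `{1,…,b}`,
with the componentwise order. -/
abbrev Box (a b : ℕ) : Type :=
  {p : ℕ × ℕ // (1 ≤ p.1 ∧ p.1 ≤ a) ∧ (1 ≤ p.2 ∧ p.2 ≤ b)}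

/-- The width of a poset: the maximum cardinality of an antichain. -/
noncomputable def widthP (P : Type*) [PartialOrder P] : ℕ :=
  sSup {k : ℕ | ∃ A : Finset P, IsAntichain (· ≤ ·) (A : Set P) ∧ A.card = k}


/-- `A_k(P)`: the set of antichains of `P` of cardinality exactly `k`. -/
def AkSet (P : Type*) [PartialOrder P] (k : ℕ) : Type _ :=
  {A : Finset P // IsAntichain (· ≤ ·) (A : Set P) ∧ A.card = k}

/-- The underlying finite set of elements of an antichain in `A_k(P)`. -/
def AkSet.carrier {P : Type*} [PartialOrder P] {k : ℕ} (A : AkSet P k) : Finset P :=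
  Subtype.val A

/-- `A ≺_k B` iff `A \ B = {a}` and `B \ A = {b}` are singletons with `a <_P b`. -/
def PrecK {P : Type*} [PartialOrder P] {k : ℕ} (A B : AkSet P k) : Prop :=
  ∃ a b : P,
    ((A.carrier : Set P) \ (B.carrier : Set P)) = {a} ∧
    ((B.carrier : Set P) \ (A.carrier : Set P)) = {b} ∧ a < b

/-- `≤_k`: the reflexive transitive closure of `≺_k` on `A_k(P)`. -/
def LeK {P : Type*} [PartialOrder P] {k : ℕ} : AkSet P k → AkSet P k → Prop :=
  Relation.ReflTransGen PrecK

/-- `A_k(P)` is equipped with the order `≤_k`. -/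
instance {P : Type*} [PartialOrder P] {k : ℕ} : LE (AkSet P k) := ⟨LeK⟩

/-- `P = J^3([2] × [3])`, the 3-fold iterated order-ideal poset of `[2] × [3]`
(order ideals realized as lower sets, ordered by inclusion). -/
abbrev P18 : Type := LowerSet (LowerSet (LowerSet (Box 2 3)))

/-- `P' = J^2([2] × [3])`. -/
abbrev P18' : Type := LowerSet (LowerSet (Box 2 3))

/-- `J^3([2] × [2])`. -/
abbrev Q18 : Type := LowerSet (LowerSet (LowerSet (Box 2 2)))

/-- `P` is coded by the relation `r` on `Fin n`. -/
def Coded18 (P : Type*) [PartialOrder P] (n : ℕ) (r : Fin n → Fin n → Bool) : Prop :=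
  ∃ e : Fin n ≃ P, ∀ i j, e i ≤ e j ↔ r i j = true

/-- The inclusion relation on a list of bitmasks. -/
def rel18 {n : ℕ} (M : Fin n → ℕ) (i j : Fin n) : Bool := (M i &&& M j) == M i

theorem coded18_lower {P : Type*} [PartialOrder P] {n m : ℕ} {r : Fin n → Fin n → Bool}
    (hP : Coded18 P n r) (M : Fin m → ℕ) (r' : Fin m → Fin m → Bool)
    (hlin : ∀ x y, r x y = true → x ≤ y)
    (h1 : ∀ i x y, r x y = true → (M i).testBit y = true → (M i).testBit x = true)
    (h0 : ∃ i, ∀ x : Fin n, (M i).testBit x = false)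
    (h2 : ∀ i, ∀ x : Fin n, (M i).testBit x = false →
      (∀ y, r y x = true → y ≠ x → (M i).testBit y = true) →
      ∃ j, ∀ y : Fin n, (M j).testBit y = ((M i).testBit y || decide (y = x)))
    (h3 : ∀ i j, (∀ x : Fin n, (M i).testBit x = true → (M j).testBit x = true) ↔ r' i j = true)
    (h4 : ∀ i j, r' i j = true → r' j i = true → i = j) :
    Coded18 (LowerSet P) m r' := by
  obtain ⟨e, he⟩ := hP
  have key : ∀ k, ∀ S : Finset (Fin n), S.card = k →
      (∀ x y, r x y = true → y ∈ S → x ∈ S) →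
      ∃ i, ∀ y : Fin n, (M i).testBit y = true ↔ y ∈ S := by
    intro k
    induction k with
    | zero =>
      intro S hS _
      obtain ⟨i, hi⟩ := h0
      refine ⟨i, fun y => ?_⟩
      rw [Finset.card_eq_zero] at hS
      simp [hi, hS]
    | succ k ih =>
      intro S hS hlow
      have hne : S.Nonempty := by
        rw [← Finset.card_pos]; omega
      set x := S.max' hne with hx
      have hxS : x ∈ S := S.max'_mem hne
      obtain ⟨i, hi⟩ := ih (S.erase x) (by rw [Finset.card_erase_of_mem hxS]; omega) (by
        intro a b hab hb
        rw [Finset.mem_erase] at hb ⊢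
        refine ⟨?_, hlow a b hab hb.2⟩
        rintro rfl
        exact hb.1 (le_antisymm (S.le_max' b hb.2) (hlin _ _ hab)))
      obtain ⟨j, hj⟩ := h2 i x (by
          have := hi x
          simpa using this) (by
          intro y hy hyx
          rw [hi, Finset.mem_erase]
          exact ⟨hyx, hlow y x hy hxS⟩)
      refine ⟨j, fun y => ?_⟩
      rw [hj, Bool.or_eq_true, hi, decide_eq_true_eq, Finset.mem_erase]
      constructor
      · rintro (h | h)
        · exact h.2
        · rw [h]; exact hxS
      · intro h
        by_cases hyx : y = x
        · exact Or.inr hyx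
        · exact Or.inl ⟨hyx, h⟩
  let f : Fin m → LowerSet P := fun i =>
    ⟨{p | (M i).testBit (e.symm p) = true}, by
      intro a b hba ha
      have : r (e.symm b) (e.symm a) = true := by
        rw [← he]; simpa using hba
      exact h1 i _ _ this ha⟩
  have hmem : ∀ i p, p ∈ f i ↔ (M i).testBit (e.symm p) = true := fun i p => Iff.rfl
  have hle : ∀ i j, f i ≤ f j ↔ r' i j = true := by
    intro i j
    rw [← h3]
    constructor
    · intro h x hx
      have := h (show e x ∈ f i by rw [hmem]; simpa using hx)
      have h' : e x ∈ f j := this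
      rw [hmem] at h'
      simpa using h'
    · intro h p hp
      exact h _ hp
  have hinj : Function.Injective f := by
    intro i j hij
    exact h4 i j ((hle i j).1 hij.le) ((hle j i).1 hij.ge)
  have hsurj : Function.Surjective f := by
    classical
    intro L
    obtain ⟨i, hi⟩ := key _ (Finset.univ.filter (fun x => e x ∈ L)) rfl (by
      intro x y hxy hy
      simp only [Finset.mem_filter, Finset.mem_univ, true_and] at hy ⊢
      exact L.lower ((he x y).2 hxy) hy)
    refine ⟨i, ?_⟩
    ext p
    change p ∈ f i ↔ p ∈ L
    rw [hmem, hi]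
    simp
  exact ⟨Equiv.ofBijective f ⟨hinj, hsurj⟩, hle⟩

theorem coded18_comp {P : Type*} [PartialOrder P] {n : ℕ} {r : Fin n → Fin n → Bool}
    (e : Fin n ≃ P) (he : ∀ i j, e i ≤ e j ↔ r i j = true) {A : Set P}
    (hA : IsAntichain (· ≤ ·) A) {p q : P} (hp : p ∈ A) (hq : q ∈ A) (hpq : p ≠ q) :
    r (e.symm p) (e.symm q) = false := by
  have := hA hp hq hpq
  rw [← Bool.not_eq_true, ← he]
  simpa using this

theorem coded18_width {P : Type*} [PartialOrder P] {n : ℕ} {r : Fin n → Fin n → Bool}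
    (hP : Coded18 P n r) (w : ℕ) (c : Fin n → Fin w)
    (hc : ∀ x y, c x = c y → r x y = true ∨ r y x = true)
    (g : Fin w → Fin n) (hg : ∀ i j, i ≠ j → r (g i) (g j) = false ∧ g i ≠ g j) :
    widthP P = w ∧ Nonempty (AkSet P w) := by
  classical
  obtain ⟨e, he⟩ := hP
  have hginj : Function.Injective (fun i => e (g i)) := by
    intro i j hij
    by_contra hne
    exact (hg i j hne).2 (e.injective hij)
  have hex : ∃ A : Finset P, IsAntichain (· ≤ ·) (A : Set P) ∧ A.card = w := by
    refine ⟨Finset.univ.map ⟨_, hginj⟩, ?_, by simp⟩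
    intro p hp q hq hpq
    simp only [Finset.coe_map, Function.Embedding.coeFn_mk, Finset.coe_univ, Set.image_univ,
      Set.mem_range] at hp hq
    obtain ⟨i, rfl⟩ := hp
    obtain ⟨j, rfl⟩ := hq
    have hij : i ≠ j := by rintro rfl; exact hpq rfl
    intro h
    have h' := (he _ _).1 h
    rw [(hg i j hij).1] at h'
    exact Bool.false_ne_true h'
  refine ⟨?_, ?_⟩
  · apply IsGreatest.csSup_eq
    refine ⟨hex, ?_⟩
    rintro k ⟨A, hA, rfl⟩
    have : A.card ≤ (Finset.univ : Finset (Fin w)).card := by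
      apply Finset.card_le_card_of_injOn (fun p => c (e.symm p))
      · intro _ _; simp
      · intro p hp q hq hpq
        by_contra hne
        rcases hc _ _ hpq with h | h
        · rw [coded18_comp e he hA hp hq hne] at h
          exact Bool.false_ne_true h
        · rw [coded18_comp e he hA hq hp (Ne.symm hne)] at h
          exact Bool.false_ne_true h
    simpa using this
  · obtain ⟨A, hA⟩ := hex
    exact ⟨⟨A, hA⟩⟩

theorem coded18_subs {P : Type*} [PartialOrder P] {n : ℕ} {r : Fin n → Fin n → Bool}
    (hP : Coded18 P n r) (a b c : Fin n)
    (h : ∀ x y, r x y = false → r y x = false → ∀ z, r x z = false → r z x = false →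
      r y z = false → r z y = false → x = a ∨ x = b ∨ x = c) :
    Subsingleton (AkSet P 3) := by
  classical
  obtain ⟨e, he⟩ := hP
  have key : ∀ A : AkSet P 3, A.1 = {e a, e b, e c} := by
    rintro ⟨A, hA, hcard⟩
    apply Finset.eq_of_subset_of_card_le
    · intro p hp
      have h2 : (A.erase p).card = 2 := by rw [Finset.card_erase_of_mem hp, hcard]
      obtain ⟨q, s, hqs, hE⟩ := Finset.card_eq_two.1 h2
      have hq : q ∈ A.erase p := by rw [hE]; simp
      have hs : s ∈ A.erase p := by rw [hE]; simp
      rw [Finset.mem_erase] at hq hs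
      have := h _ _ (coded18_comp e he hA hp hq.2 hq.1.symm)
        (coded18_comp e he hA hq.2 hp hq.1) _
        (coded18_comp e he hA hp hs.2 hs.1.symm)
        (coded18_comp e he hA hs.2 hp hs.1)
        (coded18_comp e he hA hq.2 hs.2 hqs)
        (coded18_comp e he hA hs.2 hq.2 hqs.symm)
      simpa [Equiv.symm_apply_eq] using this
    · rw [hcard]; exact Finset.card_le_three
  refine ⟨fun A B => Subtype.ext ?_⟩
  rw [key A, key B]

theorem ak18_one (P : Type*) [PartialOrder P] : Nonempty (AkSet P 1 ≃o P) := by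
  let f : P → AkSet P 1 := fun p => ⟨{p}, by simp, by simp⟩
  have hf : Function.Bijective f := by
    constructor
    · intro p q h
      exact Finset.singleton_injective (congrArg Subtype.val h)
    · rintro ⟨A, hA, hc⟩
      obtain ⟨p, rfl⟩ := Finset.card_eq_one.1 hc
      exact ⟨p, rfl⟩
  have hprec : ∀ p q, PrecK (f p) (f q) ↔ p < q := by
    intro p q
    have hcp : ∀ p, ((f p).carrier : Set P) = {p} := fun p => by simp [f, AkSet.carrier]
    simp only [PrecK, hcp]
    constructor
    · rintro ⟨a, b, h1, h2, h3⟩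
      have ha : a ∈ ({p} : Set P) \ {q} := by rw [h1]; rfl
      have hb : b ∈ ({q} : Set P) \ {p} := by rw [h2]; rfl
      have ha' : a = p := ha.1
      have hb' : b = q := hb.1
      rw [← ha', ← hb']; exact h3
    · intro h
      refine ⟨p, q, ?_, ?_, h⟩
      · ext x
        simp only [Set.mem_sdiff, Set.mem_singleton_iff]
        exact ⟨fun h => h.1, fun hx => ⟨hx, by rw [hx]; exact h.ne⟩⟩
      · ext x
        simp only [Set.mem_sdiff, Set.mem_singleton_iff]
        exact ⟨fun h => h.1, fun hx => ⟨hx, by rw [hx]; exact h.ne'⟩⟩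
  let E := Equiv.ofBijective f hf
  have hle : ∀ p q, f p ≤ f q ↔ p ≤ q := by
    intro p q
    constructor
    · intro h
      have : ∀ X Y : AkSet P 1, Relation.ReflTransGen PrecK X Y → E.symm X ≤ E.symm Y := by
        intro X Y hXY
        induction hXY with
        | refl => exact le_rfl
        | @tail Y Z _ hYZ ih =>
          refine ih.trans ?_
          have h1 : f (E.symm Y) = Y := E.apply_symm_apply Y
          have h2 : f (E.symm Z) = Z := E.apply_symm_apply Z
          rw [← h1, ← h2, hprec] at hYZ
          exact hYZ.le
      have h3 := this _ _ h
      have h1 : E.symm (f p) = p := E.symm_apply_apply p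
      have h2 : E.symm (f q) = q := E.symm_apply_apply q
      rwa [h1, h2] at h3
    · intro h
      rcases h.eq_or_lt with rfl | h
      · exact Relation.ReflTransGen.refl
      · exact Relation.ReflTransGen.single ((hprec p q).2 h)
  exact ⟨(OrderIso.symm { E with map_rel_iff' := fun {a b} => hle a b } : AkSet P 1 ≃o P)⟩

/-- The relation `≺_2` on pairs. -/
def prec18 {n : ℕ} (r : Fin n → Fin n → Bool) (p q : Fin n × Fin n) : Bool :=
  (decide (p.1 = q.1) && decide (p.2 ≠ q.2) && r p.2 q.2) ||
  (decide (p.1 = q.2) && decide (p.2 ≠ q.1) && r p.2 q.1) ||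
  (decide (p.2 = q.1) && decide (p.1 ≠ q.2) && r p.1 q.2) ||
  (decide (p.2 = q.2) && decide (p.1 ≠ q.1) && r p.1 q.1)

theorem pair18 {P : Type*} [PartialOrder P] {x y u v : P} (hxy : x ≠ y) (huv : u ≠ v) :
    (∃ a b : P, (({x, y} : Set P) \ {u, v}) = {a} ∧ (({u, v} : Set P) \ {x, y}) = {b} ∧ a < b) ↔
    (x = u ∧ y < v) ∨ (x = v ∧ y < u) ∨ (y = u ∧ x < v) ∨ (y = v ∧ x < u) := by
  constructor
  · rintro ⟨a, b, h1, h2, h3⟩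
    have e1 : ∀ z, ((z = x ∨ z = y) ∧ ¬ (z = u ∨ z = v)) ↔ z = a := by
      intro z
      have := Set.ext_iff.1 h1 z
      simpa using this
    have e2 : ∀ z, ((z = u ∨ z = v) ∧ ¬ (z = x ∨ z = y)) ↔ z = b := by
      intro z
      have := Set.ext_iff.1 h2 z
      simpa using this
    have a1 := e1 a
    have a2 := e1 x
    have a3 := e1 y
    have b1 := e2 b
    have b2 := e2 u
    have b3 := e2 v
    grind
  · have aux : ∀ s p q : P, s ≠ p → s ≠ q → p < q → (({s, p} : Set P) \ {s, q}) = {p} ∧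
        (({s, q} : Set P) \ {s, p}) = {q} ∧ p < q := by
      intro s p q hp hq h
      refine ⟨?_, ?_, h⟩
      · ext z
        have := h.ne
        simp only [Set.mem_sdiff, Set.mem_insert_iff, Set.mem_singleton_iff]
        grind
      · ext z
        have := h.ne
        simp only [Set.mem_sdiff, Set.mem_insert_iff, Set.mem_singleton_iff]
        grind
    rintro (⟨rfl, h⟩ | ⟨rfl, h⟩ | ⟨rfl, h⟩ | ⟨rfl, h⟩)
    · exact ⟨_, _, aux _ _ _ hxy huv h⟩
    · rw [Set.pair_comm u x]
      exact ⟨_, _, aux _ _ _ hxy huv.symm h⟩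
    · rw [Set.pair_comm x y]
      exact ⟨_, _, aux _ _ _ hxy.symm huv h⟩
    · rw [Set.pair_comm x y, Set.pair_comm u y]
      exact ⟨_, _, aux _ _ _ hxy.symm huv.symm h⟩

theorem coded18_two {P Q : Type*} [PartialOrder P] [PartialOrder Q] {n m : ℕ}
    {r : Fin n → Fin n → Bool} {r' : Fin m → Fin m → Bool}
    (hP : Coded18 P n r) (hQ : Coded18 Q m r') (φ : Fin m → Fin n × Fin n)
    (h1 : ∀ i, (φ i).1 < (φ i).2 ∧ r (φ i).1 (φ i).2 = false ∧ r (φ i).2 (φ i).1 = false)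
    (h2 : ∀ x y, x < y → r x y = false → r y x = false → ∃ i, φ i = (x, y))
    (h3 : ∀ i j, φ i = φ j → i = j)
    (h4 : ∀ i j, prec18 r (φ i) (φ j) = true → r' i j = true)
    (h5 : ∀ i j, r' i j = true → i = j ∨
      ∃ k, i < k ∧ prec18 r (φ i) (φ k) = true ∧ r' k j = true) :
    Nonempty (AkSet P 2 ≃o Q) := by
  classical
  obtain ⟨e, he⟩ := hP
  obtain ⟨e', he'⟩ := hQ
  have hne : ∀ i, e (φ i).1 ≠ e (φ i).2 := fun i h => (h1 i).1.ne (e.injective h)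
  let f : Fin m → AkSet P 2 := fun i => ⟨{e (φ i).1, e (φ i).2}, by
    have a1 : ¬ e (φ i).1 ≤ e (φ i).2 := by rw [he, (h1 i).2.1]; exact Bool.false_ne_true
    have a2 : ¬ e (φ i).2 ≤ e (φ i).1 := by rw [he, (h1 i).2.2]; exact Bool.false_ne_true
    intro p hp q hq hpq
    simp only [Finset.coe_insert, Finset.coe_singleton, Set.mem_insert_iff,
      Set.mem_singleton_iff] at hp hq
    rcases hp with rfl | rfl <;> rcases hq with rfl | rfl
    · exact absurd rfl hpq
    · exact a1
    · exact a2
    · exact absurd rfl hpq, Finset.card_pair (hne i)⟩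
  have hcar : ∀ i, ((f i).carrier : Set P) = {e (φ i).1, e (φ i).2} := fun i => by
    simp [f, AkSet.carrier]
  have hinj : Function.Injective f := by
    intro i j hij
    apply h3
    have h := congrArg (fun A : AkSet P 2 => (A.carrier : Set P)) hij
    simp only [hcar] at h
    have i1 := (h1 i).1
    have j1 := (h1 j).1
    rcases Set.pair_eq_pair_iff.1 h with ⟨a, b⟩ | ⟨a, b⟩
    · exact Prod.ext (e.injective a) (e.injective b)
    · rw [e.injective a, e.injective b] at i1
      exact absurd (i1.trans j1) (lt_irrefl _)
  have hsurj : Function.Surjective f := by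
    rintro ⟨A, hA, hc⟩
    obtain ⟨p, q, hpq, rfl⟩ := Finset.card_eq_two.1 hc
    have hp : p ∈ (({p, q} : Finset P) : Set P) := by simp
    have hq : q ∈ (({p, q} : Finset P) : Set P) := by simp
    have c1 := coded18_comp e he hA hp hq hpq
    have c2 := coded18_comp e he hA hq hp hpq.symm
    rcases lt_trichotomy (e.symm p) (e.symm q) with h | h | h
    · obtain ⟨i, hi⟩ := h2 _ _ h c1 c2
      refine ⟨i, Subtype.ext ?_⟩
      simp [f, hi]
    · exact absurd (e.symm.injective h) hpq
    · obtain ⟨i, hi⟩ := h2 _ _ h c2 c1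
      refine ⟨i, Subtype.ext ?_⟩
      simp [f, hi, Finset.pair_comm]
  have hlt : ∀ x y, e x < e y ↔ x ≠ y ∧ r x y = true := by
    intro x y
    rw [lt_iff_le_and_ne, he, e.injective.ne_iff, and_comm]
  have hprec : ∀ i j, PrecK (f i) (f j) ↔ prec18 r (φ i) (φ j) = true := by
    intro i j
    unfold PrecK
    rw [hcar, hcar, pair18 (hne i) (hne j)]
    simp only [hlt, e.injective.eq_iff, prec18, Bool.or_eq_true, Bool.and_eq_true,
      decide_eq_true_eq]
    tauto
  let E := Equiv.ofBijective f ⟨hinj, hsurj⟩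
  have hle1 : ∀ X Y : AkSet P 2, Relation.ReflTransGen PrecK X Y →
      e' (E.symm X) ≤ e' (E.symm Y) := by
    intro X Y hXY
    induction hXY with
    | refl => exact le_rfl
    | @tail Y Z _ hYZ ih =>
      refine ih.trans ?_
      have h1 : f (E.symm Y) = Y := E.apply_symm_apply Y
      have h2 : f (E.symm Z) = Z := E.apply_symm_apply Z
      rw [← h1, ← h2, hprec] at hYZ
      rw [he']
      exact h4 _ _ hYZ
  have hle2 : ∀ d : ℕ, ∀ i j : Fin m, m - i.1 = d → r' i j = true →
      Relation.ReflTransGen PrecK (f i) (f j) := by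
    intro d
    induction d using Nat.strong_induction_on with
    | _ d ih =>
      intro i j hd hij
      rcases h5 i j hij with rfl | ⟨k, hik, hp, hk⟩
      · exact Relation.ReflTransGen.refl
      · have hk' : i.1 < k.1 := hik
        have hkm := k.2
        exact Relation.ReflTransGen.head ((hprec i k).2 hp) (ih (m - k.1) (by omega) k j rfl hk)
  refine ⟨⟨E.symm.trans e', ?_⟩⟩
  intro X Y
  constructor
  · intro h
    have h' : r' (E.symm X) (E.symm Y) = true := by
      rw [← he']; exact h
    have := hle2 _ _ _ rfl h'
    have h1 : f (E.symm X) = X := E.apply_symm_apply X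
    have h2 : f (E.symm Y) = Y := E.apply_symm_apply Y
    rw [h1, h2] at this
    exact this
  · intro h
    exact hle1 X Y h

theorem coded18_box (a b n : ℕ) (M : Fin n → ℕ) (g : Fin n → ℕ × ℕ)
    (h1 : ∀ i, (1 ≤ (g i).1 ∧ (g i).1 ≤ a) ∧ (1 ≤ (g i).2 ∧ (g i).2 ≤ b))
    (h2 : ∀ i j, g i = g j → i = j)
    (h3 : ∀ x : Fin (a + 1), ∀ y : Fin (b + 1), 1 ≤ x.1 → 1 ≤ y.1 → ∃ i, g i = (x.1, y.1))
    (h4 : ∀ i j, ((g i).1 ≤ (g j).1 ∧ (g i).2 ≤ (g j).2) ↔ rel18 M i j = true) :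
    Coded18 (Box a b) n (rel18 M) := by
  let f : Fin n → Box a b := fun i => ⟨g i, h1 i⟩
  have hinj : Function.Injective f := fun i j h => h2 i j (congrArg Subtype.val h)
  have hsurj : Function.Surjective f := by
    rintro ⟨⟨x, y⟩, ⟨hx, hx'⟩, hy, hy'⟩
    obtain ⟨i, hi⟩ := h3 ⟨x, Nat.lt_succ_of_le hx'⟩ ⟨y, Nat.lt_succ_of_le hy'⟩ hx hy
    exact ⟨i, Subtype.ext hi⟩
  exact ⟨Equiv.ofBijective f ⟨hinj, hsurj⟩, h4⟩

def mT18_0 : Fin 6 → ℕ := fun i => ([1, 3, 7, 9, 27, 63] : List ℕ).getD i.1 0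

def mT18_1 : Fin 10 → ℕ := fun i => ([0, 1, 3, 9, 7, 11, 15, 27, 31, 63] : List ℕ).getD i.1 0

def mT18_2 : Fin 16 → ℕ := fun i => ([0, 1, 3, 7, 11, 15, 23, 31, 47, 63, 175, 127, 191, 255, 511, 1023] : List ℕ).getD i.1 0

def mT18_3 : Fin 27 → ℕ := fun i => ([0, 1, 3, 7, 15, 23, 31, 79, 63, 95, 127, 319, 255, 383, 1343, 511, 1407, 1023, 1535, 2047, 3071, 4095, 6143, 8191, 16383, 32767, 65535] : List ℕ).getD i.1 0

def mU18_0 : Fin 4 → ℕ := fun i => ([1, 3, 5, 15] : List ℕ).getD i.1 0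

def mU18_1 : Fin 6 → ℕ := fun i => ([0, 1, 3, 5, 7, 15] : List ℕ).getD i.1 0

def mU18_2 : Fin 8 → ℕ := fun i => ([0, 1, 3, 7, 11, 15, 31, 63] : List ℕ).getD i.1 0

def mU18_3 : Fin 10 → ℕ := fun i => ([0, 1, 3, 7, 15, 23, 31, 63, 127, 255] : List ℕ).getD i.1 0

theorem codT18_0 : Coded18 (Box 2 3) 6 (rel18 mT18_0) :=
  coded18_box 2 3 6 _ (fun i => ([(1, 1), (1, 2), (1, 3), (2, 1), (2, 2), (2, 3)] : List (ℕ × ℕ)).getD i.1 (0, 0))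
    (by decide +kernel) (by decide +kernel) (by decide +kernel) (by decide +kernel)

theorem codT18_1 : Coded18 (LowerSet (Box 2 3)) 10 (rel18 mT18_1) :=
  coded18_lower codT18_0 mT18_1 _
    (by decide +kernel) (by decide +kernel) (by decide +kernel) (by decide +kernel)
    (by decide +kernel) (by decide +kernel)

theorem codT18_2 : Coded18 (LowerSet (LowerSet (Box 2 3))) 16 (rel18 mT18_2) :=
  coded18_lower codT18_1 mT18_2 _
    (by decide +kernel) (by decide +kernel) (by decide +kernel) (by decide +kernel)
    (by decide +kernel) (by decide +kernel)

theorem codT18_3 : Coded18 (LowerSet (LowerSet (LowerSet (Box 2 3)))) 27 (rel18 mT18_3) :=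
  coded18_lower codT18_2 mT18_3 _
    (by decide +kernel) (by decide +kernel) (by decide +kernel) (by decide +kernel)
    (by decide +kernel) (by decide +kernel)

theorem codU18_0 : Coded18 (Box 2 2) 4 (rel18 mU18_0) :=
  coded18_box 2 2 4 _ (fun i => ([(1, 1), (1, 2), (2, 1), (2, 2)] : List (ℕ × ℕ)).getD i.1 (0, 0))
    (by decide +kernel) (by decide +kernel) (by decide +kernel) (by decide +kernel)

theorem codU18_1 : Coded18 (LowerSet (Box 2 2)) 6 (rel18 mU18_1) :=
  coded18_lower codU18_0 mU18_1 _
    (by decide +kernel) (by decide +kernel) (by decide +kernel) (by decide +kernel)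
    (by decide +kernel) (by decide +kernel)

theorem codU18_2 : Coded18 (LowerSet (LowerSet (Box 2 2))) 8 (rel18 mU18_2) :=
  coded18_lower codU18_1 mU18_2 _
    (by decide +kernel) (by decide +kernel) (by decide +kernel) (by decide +kernel)
    (by decide +kernel) (by decide +kernel)

theorem codU18_3 : Coded18 (LowerSet (LowerSet (LowerSet (Box 2 2)))) 10 (rel18 mU18_3) :=
  coded18_lower codU18_2 mU18_3 _
    (by decide +kernel) (by decide +kernel) (by decide +kernel) (by decide +kernel)
    (by decide +kernel) (by decide +kernel)

/-- For `P = J^3([2] × [3])`: the width of `P` is `3`, `(A_3(P), ≤_3)` is a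
singleton, `(A_1(P), ≤_1) ≅ P`, and `(A_2(P), ≤_2) ≅ P`.  Moreover, for
`P' = J^2([2] × [3])`, the width of `P'` is `2` and `(A_2(P'), ≤_2) ≅ J^3([2] × [2])`. -/
theorem stmt18 :
    widthP P18 = 3 ∧
    (Nonempty (AkSet P18 3) ∧ Subsingleton (AkSet P18 3)) ∧
    Nonempty (AkSet P18 1 ≃o P18) ∧
    Nonempty (AkSet P18 2 ≃o P18) ∧
    widthP P18' = 2 ∧
    Nonempty (AkSet P18' 2 ≃o Q18) := by
  have dk := coded18_width codT18_3 3
    (fun i => ([0, 0, 0, 0, 0, 1, 1, 0, 1, 0, 0, 1, 0, 1, 2, 0, 1, 0, 2, 2, 0, 2, 1, 2, 2, 1, 0] : List (Fin 3)).getD i.1 0)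
    (by decide +kernel) (fun i => ([12, 13, 14] : List (Fin 27)).getD i.1 0) (by decide +kernel)
  refine ⟨dk.1, ⟨dk.2, coded18_subs codT18_3 12 13 14 (by decide +kernel)⟩, ak18_one _, ?_, ?_, ?_⟩
  · exact coded18_two codT18_3 codT18_3
      (fun i => ([(4, 5), (5, 7), (6, 7), (7, 8), (7, 11), (8, 9), (9, 11), (7, 14), (10, 11), (9, 14), (10, 14), (11, 12), (13, 14), (12, 14), (12, 13), (14, 15), (12, 16), (14, 17), (15, 16), (16, 17), (14, 20), (16, 20), (17, 18), (18, 20), (19, 20), (20, 22), (21, 22)] : List (Fin 27 × Fin 27)).getD i.1 (0, 0))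
      (by decide +kernel) (by decide +kernel) (by decide +kernel) (by decide +kernel)
      (by decide +kernel)
  · exact (coded18_width codT18_2 2
      (fun i => ([0, 0, 0, 0, 1, 1, 0, 0, 1, 0, 1, 0, 1, 0, 0, 1] : List (Fin 2)).getD i.1 0)
      (by decide +kernel) (fun i => ([3, 4] : List (Fin 16)).getD i.1 0) (by decide +kernel)).1
  · exact coded18_two codT18_2 codU18_3
      (fun i => ([(3, 4), (4, 6), (5, 6), (6, 8), (6, 10), (7, 8), (7, 10), (9, 10), (10, 11), (11, 12)] : List (Fin 16 × Fin 16)).getD i.1 (0, 0))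
      (by decide +kernel) (by decide +kernel) (by decide +kernel) (by decide +kernel)
      (by decide +kernel)
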